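/- Let φ be a weakly holomorphic Jacobi form of weight k and positive definite index m ∈ Sym_h(ℤ)∨, and α, β ∈ ℚ^h. Then ord(φ[α,β]) ≥ ord(φ) − max{ m[s] − m[s+λ+α] : s an extreme point of the Voronoi cell V_m, λ ∈ ℤ^h }. -/

import Mathlib

noncomputable section
open Matrix Complex
open scoped Manifold MatrixGroups

abbrev SL2Z := Matrix.SpecialLinearGroup (Fin 2) ℤ
abbrev UHP := UpperHalfPlane

/-- `e(x) = exp(2 π i x)`. -/
def eC (x : ℂ) : ℂ := Complex.exp (2 * Real.pi * Complex.I * x)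

/-- Coerce a rational matrix to a complex one. -/
def mC {h : ℕ} (m : Matrix (Fin h) (Fin h) ℚ) : Matrix (Fin h) (Fin h) ℂ :=
  m.map fun a => (a : ℂ)

def intVec {h : ℕ} (v : Fin h → ℤ) : Fin h → ℂ := fun i => (v i : ℂ)
def ratVec {h : ℕ} (v : Fin h → ℚ) : Fin h → ℂ := fun i => (v i : ℂ)

/-- `m ∈ Sym_h(ℤ)∨`: symmetric with integral diagonal and half-integral
off-diagonal entries. -/
def IsJacobiIndex {h : ℕ} (m : Matrix (Fin h) (Fin h) ℚ) : Prop :=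
  m.IsSymm ∧ (∀ i, ∃ n : ℤ, m i i = n) ∧ ∀ i j, ∃ n : ℤ, 2 * m i j = n

/-- weight-`k` index-`m` Jacobi slash action of `SL(2,ℤ)`. -/
def jslashSL {h : ℕ} (k : ℤ) (m : Matrix (Fin h) (Fin h) ℚ)
    (φ : UHP → (Fin h → ℂ) → ℂ) (γ : SL2Z) : UHP → (Fin h → ℂ) → ℂ := fun τ z =>
  let c : ℂ := ((γ 1 0 : ℤ) : ℂ)
  let d : ℂ := ((γ 1 1 : ℤ) : ℂ)
  (c * (τ : ℂ) + d) ^ (-k) * eC (-(c * (z ⬝ᵥ mC m *ᵥ z)) * (c * (τ : ℂ) + d)⁻¹) *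
    φ (γ • τ) ((c * (τ : ℂ) + d)⁻¹ • z)

/-- weight-`k` index-`m` Jacobi slash action of a (real) Heisenberg element
`(λ, μ, κ)`. -/
def jslashH {h : ℕ} (m : Matrix (Fin h) (Fin h) ℚ) (φ : UHP → (Fin h → ℂ) → ℂ)
    (lam mu : Fin h → ℂ) (kap : Matrix (Fin h) (Fin h) ℂ) : UHP → (Fin h → ℂ) → ℂ :=
  fun τ z =>
    eC ((lam ⬝ᵥ mC m *ᵥ lam) * (τ : ℂ) + 2 * (lam ⬝ᵥ mC m *ᵥ z)
        + (mC m * (kap + vecMulVec mu lam)).trace) * φ τ (z + (τ : ℂ) • lam + mu)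

/-- The block matrix `(2n, rᵀ; r, 2m)` over `ℝ`. -/
def bigMat {h : ℕ} (m : Matrix (Fin h) (Fin h) ℚ) (n : ℤ) (r : Fin h → ℤ) :
    Matrix (Unit ⊕ Fin h) (Unit ⊕ Fin h) ℝ :=
  Matrix.fromBlocks (Matrix.of fun _ _ => (2 * n : ℝ)) (Matrix.of fun _ j => (r j : ℝ))
    (Matrix.of fun i _ => (r i : ℝ)) ((2 : ℝ) • m.map fun a => (a : ℝ))

/-- A weakly holomorphic Jacobi form of genus 1, cogenus `h`, weight `k` and
index `m`, bundled with its Fourier coefficients. -/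
structure WeakJacobiForm (h : ℕ) (k : ℤ) (m : Matrix (Fin h) (Fin h) ℚ) where
  toFun : UHP → (Fin h → ℂ) → ℂ
  holo_tau : ∀ z, MDifferentiable 𝓘(ℂ) 𝓘(ℂ) fun τ : UHP => toFun τ z
  holo_z : ∀ τ, Differentiable ℂ fun z => toFun τ z
  inv_sl : ∀ γ : SL2Z, jslashSL k m toFun γ = toFun
  inv_heis : ∀ (lam mu : Fin h → ℤ) (kap : Matrix (Fin h) (Fin h) ℤ),
    ((kap.map fun a => (a : ℚ)) +
      vecMulVec (fun i => (mu i : ℚ)) fun i => (lam i : ℚ)).IsSymm →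
    jslashH m toFun (intVec lam) (intVec mu) (kap.map fun a => (a : ℂ)) = toFun
  coeff : ℤ → (Fin h → ℤ) → ℂ
  expansion : ∀ τ z, toFun τ z =
    ∑' p : ℤ × (Fin h → ℤ), coeff p.1 p.2 * eC ((p.1 : ℂ) * (τ : ℂ) + intVec p.2 ⬝ᵥ z)
  bdd_below : ∃ n₀ : ℤ, ∀ n r, n < n₀ → coeff n r = 0

/-- The Fourier support condition singling out holomorphic Jacobi forms among
weakly holomorphic ones. -/
def WeakJacobiForm.IsHolomorphicJF {h : ℕ} {k : ℤ} {m : Matrix (Fin h) (Fin h) ℚ}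
    (φ : WeakJacobiForm h k m) : Prop :=
  ∀ n r, ¬ (bigMat m n r).PosSemidef → φ.coeff n r = 0

/-- Specialization `φ[α,β]` of a Jacobi form to the torsion point `z = ατ + β`. -/
def torsionSpec {h : ℕ} (m : Matrix (Fin h) (Fin h) ℚ) (φ : UHP → (Fin h → ℂ) → ℂ)
    (α β : Fin h → ℚ) : UHP → ℂ :=
  fun τ => jslashH m φ (ratVec α) (ratVec β) (vecMulVec (ratVec α) (ratVec β)) τ 0

/-- `OrdGE f c` formalizes that the vanishing order of `f` at `i∞` is at least
`c`: the function `f(τ) e(-cτ)` is bounded on `im τ ≥ 1`. -/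
def OrdGE (f : UHP → ℂ) (c : ℝ) : Prop :=
  ∃ C : ℝ, ∀ τ : UHP, 1 ≤ τ.im → ‖f τ * Complex.exp (-(2 * Real.pi * Complex.I * c * (τ : ℂ)))‖ ≤ C

/-- The weight-`k` slash action on functions on the upper half plane. -/
def eslash (k : ℤ) (f : UHP → ℂ) (γ : SL2Z) : UHP → ℂ := fun τ =>
  (((γ 1 0 : ℤ) : ℂ) * (τ : ℂ) + ((γ 1 1 : ℤ) : ℂ)) ^ (-k) * f (γ • τ)

/-- The quadratic form `m[s] = sᵀms` of a real matrix. -/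
def qfR {h : ℕ} (m : Matrix (Fin h) (Fin h) ℝ) (s : Fin h → ℝ) : ℝ :=
  s ⬝ᵥ m *ᵥ s

/-- The Voronoi cell of the lattice `(ℤ^h, s ↦ sᵀms)`. -/
def VorCell {h : ℕ} (m : Matrix (Fin h) (Fin h) ℝ) : Set (Fin h → ℝ) :=
  {s | ∀ lam : Fin h → ℤ, qfR m s ≤ qfR m (s + fun i => (lam i : ℝ))}


lemma eC_add (x y : ℂ) : eC (x + y) = eC x * eC y := by
  unfold eC; rw [mul_add, Complex.exp_add]

lemma eC_zero : eC 0 = 1 := by simp [eC]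

lemma eC_ne_zero (x : ℂ) : eC x ≠ 0 := Complex.exp_ne_zero _

lemma eC_int (n : ℤ) : eC n = 1 := by
  unfold eC
  rw [Complex.exp_eq_one_iff]
  exact ⟨n, by ring⟩

lemma norm_eC (x : ℂ) : ‖eC x‖ = Real.exp (-(2 * Real.pi * x.im)) := by
  unfold eC
  rw [Complex.norm_exp]
  congr 1
  simp

lemma eC_differentiable : Differentiable ℂ eC := by
  unfold eC; fun_prop

lemma eC_continuous : Continuous eC := eC_differentiable.continuous

lemma integral_eC_int (n : ℤ) :
    ∫ x in (0:ℝ)..1, eC (n * x) = if n = 0 then 1 else 0 := by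
  split_ifs with hn
  · simp [hn, eC_zero]
  · have hc : (2 * Real.pi * Complex.I * n : ℂ) ≠ 0 := by
      simp [hn, Real.pi_ne_zero]
    have := integral_exp_mul_complex (a := 0) (b := 1) hc
    have h2 : ∀ x : ℝ, eC (n * x) = Complex.exp (2 * Real.pi * Complex.I * n * x) := by
      intro x; unfold eC; congr 1; ring
    simp_rw [h2]
    rw [this]
    have h1 := eC_int n
    unfold eC at h1
    simp [h1]

lemma slice {ι : Type*} [Countable ι] (a : ι → ℂ) (N : ι → ℤ) (ha : Summable a) (K : ℤ) :
    ∫ x in (0:ℝ)..1, (∑' p, a p * eC (N p * x)) * eC (-(K * x)) =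
      ∑' p, if N p = K then a p else 0 := by
  have key : HasSum (fun p => ∫ x in (0:ℝ)..1, a p * eC (N p * x) * eC (-(K * x)))
      (∫ x in (0:ℝ)..1, (∑' p, a p * eC (N p * x)) * eC (-(K * x))) := by
    have hn : ∀ (n : ℤ) (x : ℝ), ‖eC (n * x)‖ = 1 := by
      intro n x; rw [norm_eC]; simp
    have hn' : ∀ (n : ℤ) (x : ℝ), ‖eC (-(n * x))‖ = 1 := by
      intro n x; rw [norm_eC]; simp
    apply intervalIntegral.hasSum_integral_of_dominated_convergence (fun p _ => ‖a p‖)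
    · intro p
      apply Continuous.aestronglyMeasurable
      have := eC_continuous
      fun_prop
    · intro p
      refine Filter.Eventually.of_forall fun x _ => ?_
      rw [norm_mul, norm_mul, hn, hn']; simp
    · exact Filter.Eventually.of_forall fun x _ => ha.norm
    · simp
    · refine Filter.Eventually.of_forall fun x _ => ?_
      apply HasSum.mul_right
      apply Summable.hasSum
      apply Summable.of_norm
      simpa [norm_mul, hn] using ha.norm
  rw [← key.tsum_eq]
  congr 1
  ext p
  have : ∀ x : ℝ, a p * eC (N p * x) * eC (-(K * x)) = a p * eC ((N p - K : ℤ) * x) := by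
    intro x
    rw [mul_assoc, ← eC_add]; congr 2; push_cast; ring
  simp_rw [this]
  rw [intervalIntegral.integral_const_mul, integral_eC_int]
  simp [sub_eq_zero]

lemma contour (G : ℂ → ℂ) (hG : Differentiable ℂ G) (hp : ∀ w, G (w + 1) = G w) (t : ℂ) :
    ∫ x in (0:ℝ)..1, G (x + t) = ∫ x in (0:ℝ)..1, G x := by
  have h1 : ∫ x in (0:ℝ)..1, G (x + t) = ∫ x in (0:ℝ)..1, G (x + t.im * I) := by
    have hper : Function.Periodic (fun x : ℝ => G (x + t.im * I)) 1 := by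
      intro x
      simp only
      rw [← hp (x + t.im * I)]
      congr 1; push_cast; ring
    have := hper.intervalIntegral_add_eq t.re 0
    have h3 := intervalIntegral.integral_comp_add_right
      (a := (0:ℝ)) (b := 1) (fun x : ℝ => G (x + t.im * I)) t.re
    rw [zero_add] at this
    rw [zero_add, add_comm (1:ℝ), this] at h3
    rw [← h3]
    congr 1; ext x; congr 1
    conv_lhs => rw [← Complex.re_add_im t]
    push_cast; ring
  rw [h1]
  have h2 := Complex.integral_boundary_rect_eq_zero_of_differentiableOn G 0 (1 + t.im * I)
    hG.differentiableOn
  simp only [Complex.zero_re, Complex.zero_im, Complex.add_re, Complex.one_re, Complex.mul_re,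
    Complex.ofReal_re, Complex.I_re, mul_zero, Complex.ofReal_im, Complex.I_im, mul_one, sub_self,
    add_zero, Complex.add_im, Complex.one_im, Complex.mul_im, zero_add, Complex.ofReal_zero,
    zero_mul, Complex.ofReal_one] at h2
  have h4 : ∀ y : ℝ, G (1 + y * I) = G (y * I) := by
    intro y; rw [add_comm, hp]
  simp_rw [h4] at h2
  rw [add_sub_assoc, sub_self, add_zero, sub_eq_zero] at h2
  exact h2.symm

lemma uniq {ι d : Type*} [Countable ι] [Fintype d] (a : ι → ℂ) (N : d → ι → ℤ)
    (hN : ∀ p q, (∀ j, N j p = N j q) → p = q) (ha : Summable a)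
    (h0 : ∀ x : d → ℝ, ∑' p, a p * eC (∑ j, (N j p : ℂ) * x j) = 0) (k : ι) : a k = 0 := by
  classical
  have key : ∀ S : Finset d, ∀ x : d → ℝ,
      ∑' p, (if ∀ j ∈ S, N j p = N j k then a p else 0) * eC (∑ j, (N j p : ℂ) * x j) = 0 := by
    intro S
    induction S using Finset.induction with
    | empty => simpa using h0
    | insert i S hi ih =>
      intro x
      set b : ι → ℂ := fun p =>
        (if ∀ j ∈ S, N j p = N j k then a p else 0) * eC (∑ j, (N j p : ℂ) * x j) with hb
      have hbs : Summable b := by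
        apply Summable.of_norm
        refine Summable.of_nonneg_of_le (fun _ => norm_nonneg _) (fun p => ?_) ha.norm
        have : ‖eC (∑ j, (N j p : ℂ) * x j)‖ = 1 := by
          rw [norm_eC]; simp
        rw [hb]; simp only [norm_mul, this, mul_one]
        split_ifs <;> simp
      have hs := slice b (N i) hbs (N i k)
      have hz : ∀ t : ℝ, ∑' p, b p * eC (N i p * t) = 0 := by
        intro t
        rw [← ih (fun j => x j + if j = i then t else 0)]
        congr 1; ext p
        rw [hb]; simp only
        rw [mul_assoc, ← eC_add]
        congr 2
        push_cast
        simp [mul_add, Finset.sum_add_distrib, apply_ite (Complex.ofReal)]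
      simp only [hz, zero_mul, intervalIntegral.integral_zero] at hs
      refine Eq.trans ?_ hs.symm
      congr 1; ext p
      rw [hb]
      simp only [Finset.forall_mem_insert]
      by_cases h1 : N i p = N i k <;> simp [h1]
  have := key Finset.univ 0
  rw [tsum_eq_single k] at this
  · simpa [eC_zero] using this
  · intro p hp
    rw [if_neg, zero_mul]
    intro h
    exact hp (hN _ _ fun j => h j (Finset.mem_univ _))

section voronoi
variable {h : ℕ}

lemma qfR_add (M : Matrix (Fin h) (Fin h) ℝ) (hM : M.IsSymm) (x y : Fin h → ℝ) :
    qfR M (x + y) = qfR M x + 2 * (x ⬝ᵥ M *ᵥ y) + qfR M y := by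
  unfold qfR
  have : y ⬝ᵥ M *ᵥ x = x ⬝ᵥ M *ᵥ y := by
    rw [dotProduct_mulVec, ← mulVec_transpose, hM.eq, dotProduct_comm]
  rw [mulVec_add, add_dotProduct, dotProduct_add, dotProduct_add, this]; ring

lemma qfR_smul (M : Matrix (Fin h) (Fin h) ℝ) (c : ℝ) (x : Fin h → ℝ) :
    qfR M (c • x) = c ^ 2 * qfR M x := by
  unfold qfR
  rw [mulVec_smul, smul_dotProduct, dotProduct_smul]; simp; ring

lemma qfR_continuous (M : Matrix (Fin h) (Fin h) ℝ) : Continuous (qfR M) := by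
  unfold qfR; fun_prop

lemma qfR_pos (M : Matrix (Fin h) (Fin h) ℝ) (hM : M.PosDef) (x : Fin h → ℝ) (hx : x ≠ 0) :
    0 < qfR M x := by
  simpa [qfR] using hM.dotProduct_mulVec_pos hx

lemma qfR_nonneg (M : Matrix (Fin h) (Fin h) ℝ) (hM : M.PosDef) (x : Fin h → ℝ) :
    0 ≤ qfR M x := by
  simpa [qfR] using hM.posSemidef.dotProduct_mulVec_nonneg x

lemma qfR_coercive (M : Matrix (Fin h) (Fin h) ℝ) (hM : M.PosDef) :
    ∃ ε > 0, ∀ x : Fin h → ℝ, ε * ‖x‖ ^ 2 ≤ qfR M x := by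
  rcases (Metric.sphere (0 : Fin h → ℝ) 1).eq_empty_or_nonempty with he | hne
  · refine ⟨1, one_pos, fun x => ?_⟩
    have hx : x = 0 := by
      by_contra hx
      have : (‖x‖⁻¹ • x) ∈ Metric.sphere (0 : Fin h → ℝ) 1 := by
        simp [norm_smul, hx]
      rw [he] at this
      exact this
    subst hx
    simp [qfR]
  · obtain ⟨x0, hx0, hmin⟩ := (isCompact_sphere (0 : Fin h → ℝ) 1).exists_isMinOn hne
      (qfR_continuous M).continuousOn
    refine ⟨qfR M x0, qfR_pos M hM x0 ?_, fun x => ?_⟩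
    · rintro rfl
      simp at hx0
    · by_cases hx : x = 0
      · subst hx; simp [qfR]
      · have hs : (‖x‖⁻¹ • x) ∈ Metric.sphere (0 : Fin h → ℝ) 1 := by
          simp [norm_smul, hx]
        have h1 : qfR M x0 ≤ qfR M (‖x‖⁻¹ • x) := hmin hs
        rw [qfR_smul] at h1
        have hx' : 0 < ‖x‖ := norm_pos_iff.mpr hx
        calc qfR M x0 * ‖x‖ ^ 2 ≤ (‖x‖⁻¹ ^ 2 * qfR M x) * ‖x‖ ^ 2 := by gcongr
          _ = qfR M x := by field_simp

lemma vor_isCompact (M : Matrix (Fin h) (Fin h) ℝ) (hM : M.PosDef) :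
    IsCompact (VorCell M) := by
  obtain ⟨ε, hε, hco⟩ := qfR_coercive M hM
  apply Metric.isCompact_of_isClosed_isBounded
  · have : VorCell M = ⋂ lam : Fin h → ℤ,
        {s | qfR M s ≤ qfR M (s + fun i => (lam i : ℝ))} := by
      ext s; simp [VorCell]
    rw [this]
    refine isClosed_iInter fun lam => isClosed_le (qfR_continuous M) ?_
    exact (qfR_continuous M).comp (by fun_prop)
  · obtain ⟨C, hC⟩ := (isCompact_closedBall (0 : Fin h → ℝ) 1).bddAbove_image
      (qfR_continuous M).continuousOn
    rw [isBounded_iff_forall_norm_le]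
    refine ⟨C / ε + 1, fun s hs => ?_⟩
    have h1 := hs (fun i => -⌊s i⌋)
    have h2 : qfR M (s + fun i => ((-⌊s i⌋ : ℤ) : ℝ)) ≤ C := by
      apply hC
      refine ⟨_, ?_, rfl⟩
      rw [mem_closedBall_zero_iff, pi_norm_le_iff_of_nonneg zero_le_one]
      intro i
      rw [Real.norm_eq_abs, abs_le]
      simp only [Pi.add_apply]
      push_cast
      have := Int.floor_le (s i)
      have := Int.lt_floor_add_one (s i)
      constructor <;> linarith
    have h3 := hco s
    have h4 : ‖s‖ ^ 2 ≤ C / ε := by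
      rw [le_div_iff₀ hε]; linarith
    nlinarith [sq_nonneg (‖s‖ - 1), norm_nonneg s]

lemma vor_exists (M : Matrix (Fin h) (Fin h) ℝ) (hM : M.PosDef) (s₀ : Fin h → ℝ) :
    ∃ lam : Fin h → ℤ, (s₀ + fun i => (lam i : ℝ)) ∈ VorCell M := by
  obtain ⟨ε, hε, hco⟩ := qfR_coercive M hM
  set T : Set (Fin h → ℤ) := {lam | qfR M (s₀ + fun i => (lam i : ℝ)) ≤ qfR M s₀} with hT
  have hfin : T.Finite := by
    obtain ⟨K, hK⟩ := exists_nat_ge (qfR M s₀ / ε + 1 + ‖s₀‖)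
    apply (Set.finite_Icc (fun _ : Fin h => -(K : ℤ)) (fun _ => (K : ℤ))).subset
    intro lam hlam
    have h1 := (hco _).trans hlam
    have h4 : ‖s₀ + fun i => (lam i : ℝ)‖ ^ 2 ≤ qfR M s₀ / ε := by
      rw [le_div_iff₀ hε]; linarith
    have h5 : ‖s₀ + fun i => (lam i : ℝ)‖ ≤ qfR M s₀ / ε + 1 := by
      nlinarith [sq_nonneg (‖s₀ + fun i => (lam i : ℝ)‖ - 1),
        norm_nonneg (s₀ + fun i => (lam i : ℝ))]
    have h6 : ∀ i, |(lam i : ℝ)| ≤ K := by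
      intro i
      have a1 := (norm_le_pi_norm (s₀ + fun i => (lam i : ℝ)) i).trans h5
      have a2 := norm_le_pi_norm s₀ i
      rw [Real.norm_eq_abs] at a1 a2
      simp only [Pi.add_apply] at a1
      have a3 : |(lam i : ℝ)| ≤ |s₀ i + lam i| + |s₀ i| := by
        have := abs_sub (s₀ i + lam i) (s₀ i)
        simpa using this
      linarith
    constructor
    · intro i
      have := (abs_le.mp (h6 i)).1
      exact_mod_cast this
    · intro i
      have := (abs_le.mp (h6 i)).2
      exact_mod_cast this
  have hne : T.Nonempty := ⟨0, by
    have : (fun i => (((0 : Fin h → ℤ) i : ℤ) : ℝ)) = (0 : Fin h → ℝ) := by ext; simp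
    show qfR M (s₀ + fun i => (((0 : Fin h → ℤ) i : ℤ) : ℝ)) ≤ qfR M s₀
    rw [this, add_zero]⟩
  obtain ⟨lam, hl, hmin⟩ := Set.exists_min_image T
    (fun lam => qfR M (s₀ + fun i => (lam i : ℝ))) hfin hne
  refine ⟨lam, fun mu => ?_⟩
  have he : (s₀ + (fun i => (lam i : ℝ)) + fun i => (mu i : ℝ)) =
      s₀ + fun i => ((lam + mu) i : ℝ) := by
    ext i; simp; ring
  rw [he]
  by_cases hmem : (lam + mu) ∈ T
  · exact hmin _ hmem
  · have : qfR M s₀ < qfR M (s₀ + fun i => ((lam + mu) i : ℝ)) := not_le.mp hmem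
    exact le_of_lt (lt_of_le_of_lt hl this)

lemma vor_bound (M : Matrix (Fin h) (Fin h) ℝ) (hM : M.PosDef) (hMs : M.IsSymm)
    (a s₀ : Fin h → ℝ) :
    ∃ lam : Fin h → ℤ, qfR M (s₀ + fun i => (lam i : ℝ)) - qfR M (s₀ + a) ≤
      sSup {x : ℝ | ∃ s ∈ Set.extremePoints ℝ (VorCell M), ∃ lam : Fin h → ℤ,
          x = qfR M s - qfR M (s + (fun i => (lam i : ℝ)) + a)} := by
  obtain ⟨lam, hl⟩ := vor_exists M hM s₀
  refine ⟨lam, ?_⟩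
  set s := s₀ + fun i => (lam i : ℝ) with hs
  have hcomp := vor_isCompact M hM
  set b : Fin h → ℝ := (fun i => ((-lam i : ℤ) : ℝ)) + a with hb
  have hsb : s₀ + a = s + b := by
    ext i; simp [hs, hb]
  -- the linear functional `-2 xᵀ M b`
  let l : StrongDual ℝ (Fin h → ℝ) := LinearMap.toContinuousLinearMap
    { toFun := fun x => -2 * (x ⬝ᵥ M *ᵥ b)
      map_add' := by intro x y; rw [add_dotProduct]; ring
      map_smul' := by intro c x; rw [smul_dotProduct]; simp; ring }
  have hl_apply : ∀ x, l x = -2 * (x ⬝ᵥ M *ᵥ b) := fun x => rfl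
  obtain ⟨z, hz, hzmax⟩ := hcomp.exists_isMaxOn ⟨s, hl⟩ l.continuous.continuousOn
  have hexp : IsExposed ℝ (VorCell M) (l.toExposed (VorCell M)) :=
    ContinuousLinearMap.toExposed.isExposed
  obtain ⟨y, hy⟩ := (hexp.isCompact hcomp).extremePoints_nonempty ⟨z, hz, hzmax⟩
  have hy' := hexp.isExtreme.extremePoints_subset_extremePoints hy
  have hle : l s ≤ l y := hy.1.2 s hl
  have hdiff : ∀ x, qfR M x - qfR M (x + b) = l x - qfR M b := by
    intro x; rw [qfR_add M hMs, hl_apply]; ring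
  rw [hsb, hdiff]
  refine le_trans (b := qfR M y - qfR M (y + b)) (by rw [hdiff]; linarith) ?_
  apply le_csSup
  · obtain ⟨C, hC⟩ := hcomp.bddAbove_image (qfR_continuous M).continuousOn
    refine ⟨C, ?_⟩
    rintro x ⟨t, ht, mu, rfl⟩
    have h1 : qfR M t ≤ C := hC ⟨t, ht.1, rfl⟩
    have h2 := qfR_nonneg M hM (t + (fun i => (mu i : ℝ)) + a)
    linarith
  · exact ⟨y, hy', fun i => -lam i, by rw [hb, add_assoc]⟩

lemma exponent_bound (M : Matrix (Fin h) (Fin h) ℝ) (hM : M.PosDef) (hMs : M.IsSymm)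
    (a : Fin h → ℝ) (n ν : ℝ) (r : Fin h → ℝ)
    (hn : ∀ lam : Fin h → ℤ, ν ≤ n + r ⬝ᵥ (fun i => (lam i : ℝ)) + qfR M (fun i => (lam i : ℝ))) :
    ν - sSup {x : ℝ | ∃ s ∈ Set.extremePoints ℝ (VorCell M), ∃ lam : Fin h → ℤ,
          x = qfR M s - qfR M (s + (fun i => (lam i : ℝ)) + a)} ≤ n + r ⬝ᵥ a + qfR M a := by
  have hdet : IsUnit M.det := hM.det_pos.ne'.isUnit
  set s₀ : Fin h → ℝ := M⁻¹ *ᵥ ((1/2 : ℝ) • r) with hs₀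
  have hr : ∀ x, 2 * (s₀ ⬝ᵥ M *ᵥ x) = r ⬝ᵥ x := by
    intro x
    rw [dotProduct_mulVec, ← mulVec_transpose, hMs.eq, hs₀, mulVec_mulVec, mul_nonsing_inv _ hdet,
      one_mulVec, smul_dotProduct]
    simp
  obtain ⟨lam, hl⟩ := vor_bound M hM hMs a s₀
  have h1 := hn lam
  rw [qfR_add M hMs, qfR_add M hMs s₀ a, hr, hr] at hl
  linarith

end voronoi

section coeffs
variable {h : ℕ}

lemma index_int (m : Matrix (Fin h) (Fin h) ℚ) (hm : IsJacobiIndex m) (lam : Fin h → ℤ) :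
    ∃ (Q : ℤ) (L : Fin h → ℤ), ((fun i => (lam i : ℚ)) ⬝ᵥ m *ᵥ (fun i => (lam i : ℚ)) = Q) ∧
      (∀ i, 2 * (m *ᵥ (fun i => (lam i : ℚ))) i = L i) := by
  obtain ⟨hsym, hdiag, hoff⟩ := hm
  choose d hd using hdiag
  choose N hN using hoff
  have hNs : ∀ i j, N i j = N j i := by
    intro i j
    have h1 := hN i j
    have h2 := hN j i
    rw [hsym.apply i j, h1] at h2
    exact_mod_cast h2
  have hNd : ∀ i, N i i = 2 * d i := by
    intro i
    have h1 := hN i i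
    rw [hd] at h1
    exact_mod_cast h1.symm
  have hdvd : (2 : ℤ) ∣ ∑ p : Fin h × Fin h, lam p.1 * lam p.2 * N p.1 p.2 := by
    refine (ZMod.intCast_zmod_eq_zero_iff_dvd _ 2).mp ?_
    push_cast
    apply Finset.sum_involution (fun p _ => p.swap)
    · intro p _
      simp only [Prod.fst_swap, Prod.snd_swap]
      rw [hNs p.2 p.1, mul_comm (lam p.2 : ZMod 2)]
      exact CharTwo.add_self_eq_zero _
    · intro p _ hp hsw
      apply hp
      have : p.2 = p.1 := congrArg Prod.fst hsw
      rw [this, hNd]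
      push_cast
      have h2 : (2 : ZMod 2) = 0 := rfl
      rw [h2]; ring
    · intros; simp
    · intros; simp
  obtain ⟨Q, hQ⟩ := hdvd
  refine ⟨Q, fun i => ∑ j, N i j * lam j, ?_, ?_⟩
  · have h2 : (2 : ℚ) * ((fun i => (lam i : ℚ)) ⬝ᵥ m *ᵥ (fun i => (lam i : ℚ))) = 2 * Q := by
      have : ((∑ p : Fin h × Fin h, lam p.1 * lam p.2 * N p.1 p.2 : ℤ) : ℚ) = 2 * Q := by
        rw [hQ]; push_cast; ring
      rw [← this, Fintype.sum_prod_type]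
      push_cast
      simp only [dotProduct, mulVec, Finset.mul_sum]
      refine Finset.sum_congr rfl fun i _ => Finset.sum_congr rfl fun j _ => ?_
      rw [← hN i j]; ring
    linarith
  · intro i
    push_cast
    simp only [dotProduct, mulVec, Finset.mul_sum]
    refine Finset.sum_congr rfl fun j _ => ?_
    rw [← hN i j]; ring

/-- The absolute value of `e(nτ + rz)` at `im τ = 1`, `im z = v`. -/
def wt (p : ℤ × (Fin h → ℤ)) (v : Fin h → ℝ) : ℝ :=
  Real.exp (-(2 * Real.pi * (p.1 + ∑ i, (p.2 i : ℝ) * v i)))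

lemma coeff_inv (c : ℤ → (Fin h → ℤ) → ℂ) (F : UHP → (Fin h → ℂ) → ℂ)
    (hF : ∀ τ, Differentiable ℂ (F τ)) (lam L : Fin h → ℤ) (Q : ℤ)
    (hLQ : ∑ i, L i * lam i = 2 * Q)
    (hper : ∀ τ z, F τ (z + intVec lam) = F τ z)
    (hfe : ∀ (τ : UHP) z,
      eC (Q * (τ : ℂ) + intVec L ⬝ᵥ z) * F τ (z + (τ : ℂ) • intVec lam) = F τ z)
    (hexp : ∀ (τ : UHP) z, F τ z = ∑' p : ℤ × (Fin h → ℤ),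
      c p.1 p.2 * eC ((p.1 : ℂ) * (τ : ℂ) + intVec p.2 ⬝ᵥ z))
    (v : Fin h → ℝ)
    (hsum : Summable fun p : ℤ × (Fin h → ℤ) => ‖c p.1 p.2‖ * wt p v) (n : ℤ) (r : Fin h → ℤ) :
    c n r = c (n - ∑ i, r i * lam i + Q) (r - L) := by
  classical
  set N : ℤ × (Fin h → ℤ) → ℤ := fun p => ∑ i, p.2 i * lam i with hNdef
  have hNC : ∀ p : ℤ × (Fin h → ℤ), intVec p.2 ⬝ᵥ intVec lam = (N p : ℂ) := by
    intro p; simp [hNdef, dotProduct, intVec]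
  have hLC : intVec L ⬝ᵥ intVec lam = 2 * (Q : ℂ) := by
    have : ((∑ i, L i * lam i : ℤ) : ℂ) = 2 * Q := by rw [hLQ]; push_cast; ring
    rw [← this]; simp [dotProduct, intVec]
  -- the index shift
  let σ : ℤ × (Fin h → ℤ) ≃ ℤ × (Fin h → ℤ) :=
    { toFun := fun p => (p.1 - N p + Q, p.2 - L)
      invFun := fun p => (p.1 + N p + Q, p.2 + L)
      left_inv := by
        intro p
        ext i
        · simp only [hNdef, Pi.sub_apply, sub_mul, Finset.sum_sub_distrib, hLQ]; ring
        · simp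
      right_inv := by
        intro p
        ext i
        · simp only [hNdef, Pi.add_apply, add_mul, Finset.sum_add_distrib, hLQ]; ring
        · simp }
  have hσ1 : ∀ p, (σ p).1 = p.1 - N p + Q := fun p => rfl
  have hσ2 : ∀ p, (σ p).2 = p.2 - L := fun p => rfl
  have hNσ : ∀ p, N (σ p) = N p - 2 * Q := by
    intro p
    simp only [hNdef, hσ2, Pi.sub_apply, sub_mul, Finset.sum_sub_distrib, hLQ]
  -- the terms of the series
  let A : ℂ → (Fin h → ℂ) → ℤ × (Fin h → ℤ) → ℂ := fun τ z p =>
    c p.1 p.2 * eC ((p.1 : ℂ) * τ + intVec p.2 ⬝ᵥ z)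
  have hAsum : ∀ (τ : ℂ) (z : Fin h → ℂ), τ.im = 1 → (∀ i, (z i).im = v i) →
      Summable (A τ z) := by
    intro τ z hτ hz
    apply Summable.of_norm
    convert hsum using 2 with p
    simp only [A, norm_mul, norm_eC, wt]
    congr 4
    simp [dotProduct, intVec, hτ, hz]
  have hAσ : ∀ (τ : ℂ) (z : Fin h → ℂ) p, A τ z (σ p) * eC ((N p - Q) * τ + intVec L ⬝ᵥ z) =
      c (σ p).1 (σ p).2 * eC ((p.1 : ℂ) * τ + intVec p.2 ⬝ᵥ z) := by
    intro τ z p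
    simp only [A]
    rw [mul_assoc, ← eC_add]
    congr 2
    have : intVec (σ p).2 ⬝ᵥ z = intVec p.2 ⬝ᵥ z - intVec L ⬝ᵥ z := by
      rw [← sub_dotProduct]; congr 1; ext i; simp [intVec, hσ2]
    rw [this, hσ1]; push_cast; ring
  -- slices
  have hslice : ∀ (τ : UHP) (z : Fin h → ℂ) (K : ℤ), τ.im = 1 → (∀ i, (z i).im = v i) →
      ∑' p, (if N p = K then A τ z p else 0) =
        eC ((K - Q) * (τ : ℂ) + intVec L ⬝ᵥ z) * ∑' p, (if N p = K - 2 * Q then A τ z p else 0) := by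
    intro τ z K hτ hz
    set G : ℂ → ℂ := fun w => F τ (z + w • intVec lam) with hG
    have hGd : Differentiable ℂ G := by
      apply (hF τ).comp; fun_prop
    have hGp : ∀ w, G (w + 1) = G w := by
      intro w
      simp only [hG]
      rw [← hper τ (z + w • intVec lam)]
      congr 1; rw [add_smul, one_smul, add_assoc]
    have hGs : ∀ x : ℝ, G x = ∑' p, A τ z p * eC (N p * x) := by
      intro x
      simp only [hG, hexp, A]
      congr 1; ext p
      rw [mul_assoc, ← eC_add]
      congr 2
      rw [dotProduct_add, dotProduct_smul, hNC, smul_eq_mul]; ring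
    have hs1 := slice (A τ z) N (hAsum τ z hτ hz) K
    have hs2 := slice (A τ z) N (hAsum τ z hτ hz) (K - 2 * Q)
    simp_rw [← hGs] at hs1 hs2
    rw [← hs1, ← hs2]
    set H : ℂ → ℂ := fun w => G w * eC (-(((K - 2 * Q : ℤ) : ℂ) * w)) with hH
    have hHd : Differentiable ℂ H := by
      apply hGd.mul
      apply eC_differentiable.comp; fun_prop
    have hHp : ∀ w, H (w + 1) = H w := by
      intro w
      simp only [hH]
      rw [hGp]
      congr 1
      have : -(((K - 2 * Q : ℤ) : ℂ) * (w + 1)) =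
        -(((K - 2 * Q : ℤ) : ℂ) * w) + ((-(K - 2 * Q) : ℤ) : ℂ) := by push_cast; ring
      rw [this, eC_add, eC_int, mul_one]
    rw [← contour H hHd hHp τ, ← intervalIntegral.integral_const_mul]
    congr 1; ext x
    have hf := hfe τ (z + (x : ℂ) • intVec lam)
    simp only [hH]
    have hGx : G x = eC (Q * (τ : ℂ) + intVec L ⬝ᵥ (z + (x : ℂ) • intVec lam)) * G (x + τ) := by
      simp only [hG]
      rw [← hf]; congr 2; rw [add_smul, add_assoc]
    rw [hGx, mul_right_comm, ← eC_add, mul_left_comm, mul_comm, ← eC_add]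
    congr 2
    rw [dotProduct_add, dotProduct_smul, hLC, smul_eq_mul]
    push_cast; ring
  -- fix the slice
  set K := N (n, r) with hK
  set τ₀ : ℂ := I with hτ₀
  set z₀ : Fin h → ℂ := fun i => (v i : ℂ) * I with hz₀
  set b : ℤ × (Fin h → ℤ) → ℂ := fun p =>
    if N p = K then A τ₀ z₀ p - c (σ p).1 (σ p).2 * eC ((p.1 : ℂ) * τ₀ + intVec p.2 ⬝ᵥ z₀) else 0
    with hb
  have hsumσ : ∀ (τ : ℂ) (z : Fin h → ℂ), τ.im = 1 → (∀ i, (z i).im = v i) →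
      Summable (fun p => if N p = K then
        c (σ p).1 (σ p).2 * eC ((p.1 : ℂ) * τ + intVec p.2 ⬝ᵥ z) else 0) := by
    intro τ z hτ hz
    have h1 := (σ.summable_iff.mpr (hAsum τ z hτ hz)).mul_right
      (eC ((K - Q) * τ + intVec L ⬝ᵥ z))
    have h2 := h1.indicator {p | N p = K}
    refine h2.congr fun p => ?_
    by_cases hp : N p = K
    · rw [Set.indicator_of_mem (by exact hp), if_pos hp, ← hAσ, hp]; rfl
    · rw [Set.indicator_of_notMem (by exact hp), if_neg hp]
  have hsum1 : ∀ (τ : ℂ) (z : Fin h → ℂ), τ.im = 1 → (∀ i, (z i).im = v i) →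
      Summable (fun p => if N p = K then A τ z p else 0) := by
    intro τ z hτ hz
    have h2 := (hAsum τ z hτ hz).indicator {p | N p = K}
    refine h2.congr fun p => ?_
    by_cases hp : N p = K
    · rw [Set.indicator_of_mem (by exact hp), if_pos hp]
    · rw [Set.indicator_of_notMem (by exact hp), if_neg hp]
  have hτ₀im : τ₀.im = 1 := by simp [hτ₀]
  have hz₀im : ∀ i, (z₀ i).im = v i := by intro i; simp [hz₀]
  have hbs : Summable b := by
    refine ((hsum1 τ₀ z₀ hτ₀im hz₀im).sub (hsumσ τ₀ z₀ hτ₀im hz₀im)).congr fun p => ?_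
    simp only [hb]; split_ifs <;> simp
  have hb0 : b (n, r) = 0 := by
    apply uniq b (fun (j : Option (Fin h)) (p : ℤ × (Fin h → ℤ)) => j.elim p.1 p.2)
      _ hbs _ (n, r)
    · intro p q hpq
      ext i
      · exact hpq none
      · exact hpq (some i)
    · intro x
      set τ : UHP := ⟨x none + I, by simp⟩ with hτ
      set z : Fin h → ℂ := fun i => x (some i) + v i * I with hz
      have hτC : (τ : ℂ) = x none + I := rfl
      have hτim : τ.im = 1 := by
        show (x none + I : ℂ).im = 1
        simp
      have hzim : ∀ i, (z i).im = v i := by intro i; simp [hz]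
      have hs := hslice τ z K hτim hzim
      rw [← σ.tsum_eq (fun p => if N p = K - 2 * Q then A τ z p else 0), ← tsum_mul_left] at hs
      have hs' : ∑' p, (if N p = K then A τ z p else 0) =
          ∑' p, (if N p = K then
            c (σ p).1 (σ p).2 * eC ((p.1 : ℂ) * τ + intVec p.2 ⬝ᵥ z) else 0) := by
        rw [hs]
        congr 1; ext p
        rw [hNσ]
        by_cases hp : N p = K
        · rw [if_pos (by rw [hp]), if_pos hp, ← hAσ, hp, mul_comm]
        · rw [if_neg (by intro h; apply hp; linarith), if_neg hp, mul_zero]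
      rw [← sub_eq_zero, ← (hsum1 τ z hτim hzim).tsum_sub (hsumσ τ z hτim hzim)] at hs'
      rw [← hs']
      congr 1; ext p
      simp only [hb]
      split_ifs with hp
      · have : eC ((p.1 : ℂ) * τ + intVec p.2 ⬝ᵥ z) = eC ((p.1 : ℂ) * τ₀ + intVec p.2 ⬝ᵥ z₀) *
          eC (∑ j : Option (Fin h), ((j.elim p.1 p.2 : ℤ) : ℂ) * x j) := by
          rw [← eC_add]; congr 1
          rw [Fintype.sum_option, hτC]
          simp only [dotProduct, hz, hz₀, mul_add, Finset.sum_add_distrib, intVec, hτ₀,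
            Option.elim]
          ring
        simp only [A]
        rw [this]; ring
      · simp
  simp only [hb] at hb0
  rw [if_pos hK.symm, sub_eq_zero] at hb0
  simp only [A] at hb0
  exact mul_right_cancel₀ (eC_ne_zero _) hb0

end coeffs

section final
variable {h : ℕ}

lemma wt_add (p : ℤ × (Fin h → ℤ)) (v t : Fin h → ℝ) :
    wt p (v + t) = wt p v * ∏ i, Real.exp (-(2 * Real.pi * (p.2 i * t i))) := by
  unfold wt
  rw [← Real.exp_sum, ← Real.exp_add]
  congr 1
  simp only [Pi.add_apply, mul_add, Finset.sum_add_distrib, Finset.sum_neg_distrib, Finset.mul_sum]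
  ring

lemma wt_le (p : ℤ × (Fin h → ℤ)) (v t : Fin h → ℝ) (K : ℤ) (hK : ∀ i, |t i| ≤ K) :
    wt p (v + t) ≤ ∑ e ∈ Fintype.piFinset (fun _ : Fin h => ({-K, K} : Finset ℤ)),
      wt p (v + fun i => (e i : ℝ)) := by
  simp_rw [wt_add]
  rw [← Finset.mul_sum, ← Finset.prod_univ_sum (fun _ : Fin h => ({-K, K} : Finset ℤ))
    (fun i j => Real.exp (-(2 * Real.pi * (p.2 i * (j : ℝ)))))]
  have hw : 0 ≤ wt p v := (Real.exp_pos _).le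
  refine mul_le_mul_of_nonneg_left ?_ hw
  refine Finset.prod_le_prod (fun i _ => (Real.exp_pos _).le) fun i _ => ?_
  have ht := abs_le.mp (hK i)
  have hpi := Real.pi_pos
  rcases le_total 0 (p.2 i : ℝ) with hr | hr
  · refine le_trans ?_ (Finset.single_le_sum
      (f := fun j : ℤ => Real.exp (-(2 * Real.pi * (p.2 i * (j : ℝ)))))
      (fun j _ => (Real.exp_pos _).le) (show -K ∈ ({-K, K} : Finset ℤ) by simp))
    apply Real.exp_le_exp.mpr
    push_cast
    have : (p.2 i : ℝ) * (-K) ≤ p.2 i * t i := mul_le_mul_of_nonneg_left ht.1 hr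
    nlinarith
  · refine le_trans ?_ (Finset.single_le_sum
      (f := fun j : ℤ => Real.exp (-(2 * Real.pi * (p.2 i * (j : ℝ)))))
      (fun j _ => (Real.exp_pos _).le) (show K ∈ ({-K, K} : Finset ℤ) by simp))
    apply Real.exp_le_exp.mpr
    have : (p.2 i : ℝ) * K ≤ p.2 i * t i := mul_le_mul_of_nonpos_left ht.2 hr
    nlinarith

lemma jac_inv {k : ℤ} {m : Matrix (Fin h) (Fin h) ℚ} (hm : IsJacobiIndex m)
    (φ : WeakJacobiForm h k m) (v : Fin h → ℝ)
    (hsum : Summable fun p : ℤ × (Fin h → ℤ) => ‖φ.coeff p.1 p.2‖ * wt p v) (lam : Fin h → ℤ) :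
    ∃ (Q : ℤ) (L : Fin h → ℤ), qfR (m.map fun a => (a : ℝ)) (fun i => (lam i : ℝ)) = Q ∧
      ∀ n r, φ.coeff n r = φ.coeff (n - ∑ i, r i * lam i + Q) (r - L) := by
  obtain ⟨Q, L, hQ, hL⟩ := index_int m hm lam
  refine ⟨Q, L, ?_, ?_⟩
  · have : (((fun i => (lam i : ℚ)) ⬝ᵥ m *ᵥ (fun i => (lam i : ℚ)) : ℚ) : ℝ) = Q := by
      rw [hQ]; simp
    rw [← this]
    simp [qfR, dotProduct, mulVec]
  · have hQC : intVec lam ⬝ᵥ mC m *ᵥ intVec lam = Q := by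
      have : (((fun i => (lam i : ℚ)) ⬝ᵥ m *ᵥ (fun i => (lam i : ℚ)) : ℚ) : ℂ) = Q := by
        rw [hQ]; simp
      rw [← this]
      simp [dotProduct, mulVec, intVec, mC]
    have hLC : (2 : ℂ) • (mC m *ᵥ intVec lam) = intVec L := by
      ext i
      have : ((2 * (m *ᵥ (fun i => (lam i : ℚ))) i : ℚ) : ℂ) = L i := by rw [hL]; simp
      simp only [intVec, ← this]
      simp [dotProduct, mulVec, mC, intVec]
    have hsymC : (mC m)ᵀ = mC m := by
      ext i j
      simp [mC, hm.1.apply i j]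
    have hLz : ∀ z : Fin h → ℂ, 2 * (intVec lam ⬝ᵥ mC m *ᵥ z) = intVec L ⬝ᵥ z := by
      intro z
      rw [dotProduct_mulVec, ← mulVec_transpose, hsymC, ← hLC, smul_dotProduct, smul_eq_mul]
    have hLQ : ∑ i, L i * lam i = 2 * Q := by
      have : (intVec L ⬝ᵥ intVec lam : ℂ) = 2 * Q := by rw [← hLz, hQC]
      have h2 : (((∑ i, L i * lam i : ℤ)) : ℂ) = ((2 * Q : ℤ) : ℂ) := by
        push_cast
        rw [← this]; simp [dotProduct, intVec]
      exact_mod_cast h2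
    have hi0 : intVec (0 : Fin h → ℤ) = 0 := by ext; simp [intVec]
    have hk0 : ((0 : Matrix (Fin h) (Fin h) ℤ).map fun a => (a : ℂ)) = 0 := by ext; simp
    apply coeff_inv φ.coeff φ.toFun φ.holo_z lam L Q hLQ _ _ φ.expansion v hsum
    · intro τ z
      have h1 := φ.inv_heis 0 lam 0 (by ext; simp [vecMulVec])
      have h2 := congrFun (congrFun h1 τ) z
      rw [hi0, hk0] at h2
      simpa [jslashH, eC_zero] using h2
    · intro τ z
      have h1 := φ.inv_heis lam 0 0 (by ext; simp [vecMulVec])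
      have h2 := congrFun (congrFun h1 τ) z
      rw [hi0, hk0] at h2
      simpa [jslashH, eC_zero, hLz, hQC] using h2

lemma sum_shift {k : ℤ} {m : Matrix (Fin h) (Fin h) ℚ} (hm : IsJacobiIndex m)
    (φ : WeakJacobiForm h k m) (v : Fin h → ℝ)
    (hsum : Summable fun p : ℤ × (Fin h → ℤ) => ‖φ.coeff p.1 p.2‖ * wt p v) (lam : Fin h → ℤ) :
    Summable fun p : ℤ × (Fin h → ℤ) =>
      ‖φ.coeff p.1 p.2‖ * wt p (v + fun i => (lam i : ℝ)) := by
  obtain ⟨Q, L, -, hinv⟩ := jac_inv hm φ v hsum (-lam)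
  let σ : ℤ × (Fin h → ℤ) → ℤ × (Fin h → ℤ) :=
    fun p => (p.1 - ∑ i, p.2 i * (-lam) i + Q, p.2 - L)
  have hσ : Function.Injective σ := by
    rintro ⟨n, r⟩ ⟨n', r'⟩ hpq
    simp only [σ, Prod.mk.injEq, sub_left_inj] at hpq
    obtain ⟨h1, rfl⟩ := hpq
    simpa using h1
  have h1 := (hsum.comp_injective hσ).mul_right
    (Real.exp (2 * Real.pi * (Q - ∑ i, (L i : ℝ) * v i)))
  refine h1.congr fun p => ?_
  simp only [Function.comp, σ]
  rw [← hinv, mul_assoc]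
  congr 1
  unfold wt
  rw [← Real.exp_add]
  congr 1
  simp only [Pi.add_apply, Pi.sub_apply, Pi.neg_apply, Int.cast_sub, Int.cast_add, Int.cast_neg,
    Int.cast_sum, Int.cast_mul, mul_add, sub_mul, mul_neg,
    Finset.sum_add_distrib, Finset.sum_sub_distrib, Finset.sum_neg_distrib]
  ring

lemma sum_all {k : ℤ} {m : Matrix (Fin h) (Fin h) ℚ} (hm : IsJacobiIndex m)
    (φ : WeakJacobiForm h k m) (v : Fin h → ℝ)
    (hsum : Summable fun p : ℤ × (Fin h → ℤ) => ‖φ.coeff p.1 p.2‖ * wt p v) (w : Fin h → ℝ) :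
    Summable fun p : ℤ × (Fin h → ℤ) => ‖φ.coeff p.1 p.2‖ * wt p w := by
  set t := w - v with ht
  have hw : w = v + t := by rw [ht]; abel
  obtain ⟨K, hK⟩ := exists_nat_ge ‖t‖
  have hK' : ∀ i, |t i| ≤ ((K : ℤ) : ℝ) := by
    intro i
    have := (norm_le_pi_norm t i).trans hK
    simpa using this
  rw [hw]
  refine Summable.of_nonneg_of_le (fun p => mul_nonneg (norm_nonneg _) (Real.exp_pos _).le)
    (fun p => mul_le_mul_of_nonneg_left (wt_le p v t K hK') (norm_nonneg _)) ?_
  simp_rw [Finset.mul_sum]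
  exact summable_sum fun e _ => sum_shift hm φ v hsum e

lemma zero_case {k : ℤ} {m : Matrix (Fin h) (Fin h) ℚ}
    (φ : WeakJacobiForm h k m)
    (hno : ∀ v : Fin h → ℝ,
      ¬ Summable fun p : ℤ × (Fin h → ℤ) => ‖φ.coeff p.1 p.2‖ * wt p v) (τ : UHP)
    (z : Fin h → ℂ) : φ.toFun τ z = 0 := by
  obtain ⟨n₀, hn₀⟩ := φ.bdd_below
  have hsmall : ∀ τ : UHP, τ.im ≤ 1 → φ.toFun τ z = 0 := by
    intro τ hτ
    rw [φ.expansion]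
    apply tsum_eq_zero_of_not_summable
    intro hs
    apply hno (fun i => (z i).im)
    refine Summable.of_nonneg_of_le (fun p => mul_nonneg (norm_nonneg _) (Real.exp_pos _).le)
      (fun p => ?_) (hs.norm.mul_right (Real.exp (-(2 * Real.pi * (n₀ * (1 - τ.im))))))
    by_cases hp : p.1 < n₀
    · simp [hn₀ _ _ hp]
    · have hp' : (n₀ : ℝ) ≤ p.1 := by exact_mod_cast not_lt.mp hp
      rw [norm_mul, norm_eC, mul_assoc, ← Real.exp_add]
      refine mul_le_mul_of_nonneg_left ?_ (norm_nonneg _)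
      apply Real.exp_le_exp.mpr
      have him : ((p.1 : ℂ) * (τ : ℂ) + intVec p.2 ⬝ᵥ z).im =
          p.1 * τ.im + ∑ i, (p.2 i : ℝ) * (z i).im := by
        simp [dotProduct, intVec]
      rw [him]
      have h1 : (n₀ : ℝ) * (1 - τ.im) ≤ p.1 * (1 - τ.im) :=
        mul_le_mul_of_nonneg_right hp' (by linarith)
      have hpi := Real.pi_pos
      nlinarith
  have hd := UpperHalfPlane.mdifferentiable_iff.mp (φ.holo_tau z)
  have han := hd.analyticOnNhd UpperHalfPlane.isOpen_upperHalfPlaneSet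
  have hpre : IsPreconnected {z : ℂ | 0 < z.im} := (convex_halfSpace_im_gt 0).isPreconnected
  have hz0 := han.eqOn_zero_of_preconnected_of_eventuallyEq_zero hpre (z₀ := I / 2)
    (show 0 < (I / 2 : ℂ).im by simp) (by
      have hopen : IsOpen {w : ℂ | 0 < w.im ∧ w.im < 1} :=
        (isOpen_lt continuous_const Complex.continuous_im).inter
          (isOpen_lt Complex.continuous_im continuous_const)
      filter_upwards [hopen.mem_nhds (show 0 < (I / 2 : ℂ).im ∧ (I / 2 : ℂ).im < 1 by
        constructor <;> simp <;> norm_num)] with w hw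
      have h2 : UpperHalfPlane.ofComplex w = ⟨w, hw.1⟩ := UpperHalfPlane.ofComplex_apply_of_im_pos hw.1
      simp only [Function.comp, Pi.zero_apply]
      rw [h2]
      apply hsmall
      exact hw.2.le)
  have := hz0 (show 0 < (τ : ℂ).im from τ.im_pos)
  simpa using this

end final

/-- Lower bound on the vanishing order at infinity of a torsion specialization
`φ[α,β]` of a weakly holomorphic Jacobi form with positive definite index `m`:
`ord(φ[α,β]) ≥ ord(φ) − max{m[s] − m[s+λ+α] : s extreme point of V_m, λ ∈ ℤ^h}`. -/
theorem stmt15 (h : ℕ) (k : ℤ) (m : Matrix (Fin h) (Fin h) ℚ)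
    (hm : IsJacobiIndex m) (hpd : (m.map fun a => (a : ℝ)).PosDef)
    (φ : WeakJacobiForm h k m) (α β : Fin h → ℚ) (ν : ℤ)
    (hν : ∀ n r, n < ν → φ.coeff n r = 0) :
    OrdGE (torsionSpec m φ.toFun α β)
      ((ν : ℝ) - sSup {x : ℝ |
        ∃ s ∈ Set.extremePoints ℝ (VorCell (m.map fun a => (a : ℝ))),
        ∃ lam : Fin h → ℤ,
          x = qfR (m.map fun a => (a : ℝ)) s -
            qfR (m.map fun a => (a : ℝ))
              (s + (fun i => (lam i : ℝ)) + fun i => (α i : ℝ))}) := by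
  set M : Matrix (Fin h) (Fin h) ℝ := m.map fun a => (a : ℝ) with hM
  set a : Fin h → ℝ := fun i => (α i : ℝ) with ha
  have hMs : M.IsSymm := by
    ext i j
    simp [hM, hm.1.apply i j]
  set c₀ : ℝ := (ν : ℝ) - sSup {x : ℝ | ∃ s ∈ Set.extremePoints ℝ (VorCell M),
    ∃ lam : Fin h → ℤ, x = qfR M s - qfR M (s + (fun i => (lam i : ℝ)) + a)} with hc₀
  by_cases hex : ∃ v : Fin h → ℝ,
      Summable fun p : ℤ × (Fin h → ℤ) => ‖φ.coeff p.1 p.2‖ * wt p v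
  swap
  · refine ⟨0, fun τ _ => ?_⟩
    have := zero_case φ (not_exists.mp hex) τ
    simp [torsionSpec, jslashH, this]
  obtain ⟨v, hv⟩ := hex
  have hsum := sum_all hm φ v hv a
  have hexpo : ∀ n r, φ.coeff n r ≠ 0 → c₀ ≤ n + ∑ i, (r i : ℝ) * a i + qfR M a := by
    intro n r hnr
    refine exponent_bound M hpd hMs a n ν (fun i => (r i : ℝ)) fun lam => ?_
    obtain ⟨Q, L, hQ, hinv⟩ := jac_inv hm φ v hv (-lam)
    rw [hinv] at hnr
    have h1 : ν ≤ n - ∑ i, r i * (-lam) i + Q := by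
      by_contra hlt
      exact hnr (hν _ _ (not_le.mp hlt))
    have h2 : qfR M (fun i => (lam i : ℝ)) = Q := by
      rw [← hQ]
      have : (fun i => (((-lam) i : ℤ) : ℝ)) = (-1 : ℝ) • (fun i => (lam i : ℝ)) := by
        ext i; simp
      rw [this, qfR_smul]; simp [hM]
    have h3 : (ν : ℝ) ≤ ((n - ∑ i, r i * (-lam) i + Q : ℤ) : ℝ) := by exact_mod_cast h1
    rw [h2]
    push_cast at h3
    simpa [dotProduct] using h3
  set q := qfR M a with hq
  set B : ℝ := ∑' p : ℤ × (Fin h → ℤ), ‖φ.coeff p.1 p.2‖ * wt p a with hB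
  have hφ : ∀ τ : UHP, 1 ≤ τ.im → ‖φ.toFun τ (0 + (τ : ℂ) • ratVec α + ratVec β)‖ ≤
      B * (Real.exp (2 * Real.pi * (c₀ - q)) * Real.exp (-(2 * Real.pi * (c₀ - q) * τ.im))) := by
    intro τ hτ
    rw [φ.expansion]
    refine tsum_of_norm_bounded (hsum.hasSum.mul_right _) fun p => ?_
    by_cases hp : φ.coeff p.1 p.2 = 0
    · simp [hp]
    rw [norm_mul, norm_eC, mul_assoc ‖φ.coeff p.1 p.2‖]
    refine mul_le_mul_of_nonneg_left ?_ (norm_nonneg _)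
    unfold wt
    rw [← Real.exp_add, ← Real.exp_add]
    apply Real.exp_le_exp.mpr
    have him : ((p.1 : ℂ) * (τ : ℂ) +
        intVec p.2 ⬝ᵥ (0 + (τ : ℂ) • ratVec α + ratVec β)).im =
          (p.1 + ∑ i, (p.2 i : ℝ) * a i) * τ.im := by
      have hre : ∀ (γ : Fin h → ℚ) i, (ratVec γ i).re = (γ i : ℝ) := by
        intro γ i; simp [ratVec]
      have him' : ∀ (γ : Fin h → ℚ) i, (ratVec γ i).im = 0 := by
        intro γ i; simp [ratVec]
      simp only [dotProduct, intVec, ha, add_mul, Finset.sum_mul]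
      simp [hre, him']
      refine Finset.sum_congr rfl fun i _ => ?_
      ring
    rw [him]
    have h1 := hexpo _ _ hp
    have h2 : 0 ≤ (p.1 + ∑ i, (p.2 i : ℝ) * a i + q - c₀) * (τ.im - 1) :=
      mul_nonneg (by linarith) (by linarith)
    have hpi := Real.pi_pos
    nlinarith
  set κ : ℂ := 2 * (ratVec α ⬝ᵥ mC m *ᵥ (0 : Fin h → ℂ)) +
    (mC m * (vecMulVec (ratVec α) (ratVec β) + vecMulVec (ratVec β) (ratVec α))).trace with hκ
  have hqC : ratVec α ⬝ᵥ mC m *ᵥ ratVec α = ((q : ℝ) : ℂ) := by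
    simp [hq, hM, ha, qfR, dotProduct, mulVec, ratVec, mC]
  refine ⟨‖eC κ‖ * (B * Real.exp (2 * Real.pi * (c₀ - q))), fun τ hτ => ?_⟩
  have hf : torsionSpec m φ.toFun α β τ = eC ((q : ℂ) * τ) * eC κ *
      φ.toFun τ (0 + (τ : ℂ) • ratVec α + ratVec β) := by
    simp only [torsionSpec, jslashH]
    rw [← eC_add, hqC, add_assoc]
  have hE : ‖Complex.exp (-(2 * Real.pi * Complex.I * c₀ * (τ : ℂ)))‖ =
      Real.exp (2 * Real.pi * c₀ * τ.im) := by
    rw [Complex.norm_exp]; congr 1; simp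
  have hE2 : ‖eC ((q : ℂ) * τ)‖ = Real.exp (-(2 * Real.pi * q * τ.im)) := by
    rw [norm_eC]; congr 1; simp; ring
  rw [hf, norm_mul, norm_mul, norm_mul, hE, hE2]
  calc Real.exp (-(2 * Real.pi * q * τ.im)) * ‖eC κ‖ *
        ‖φ.toFun τ (0 + (τ : ℂ) • ratVec α + ratVec β)‖ * Real.exp (2 * Real.pi * c₀ * τ.im)
      ≤ Real.exp (-(2 * Real.pi * q * τ.im)) * ‖eC κ‖ *
        (B * (Real.exp (2 * Real.pi * (c₀ - q)) * Real.exp (-(2 * Real.pi * (c₀ - q) * τ.im)))) *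
          Real.exp (2 * Real.pi * c₀ * τ.im) := by
        gcongr
        exact hφ τ hτ
    _ = ‖eC κ‖ * (B * Real.exp (2 * Real.pi * (c₀ - q))) *
        (Real.exp (-(2 * Real.pi * q * τ.im)) * Real.exp (-(2 * Real.pi * (c₀ - q) * τ.im)) *
          Real.exp (2 * Real.pi * c₀ * τ.im)) := by ring
    _ = ‖eC κ‖ * (B * Real.exp (2 * Real.pi * (c₀ - q))) := by
        rw [← Real.exp_add, ← Real.exp_add]
        rw [show -(2 * Real.pi * q * τ.im) + -(2 * Real.pi * (c₀ - q) * τ.im) +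
          2 * Real.pi * c₀ * τ.im = 0 by ring, Real.exp_zero, mul_one]
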